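/- Lemma 3 (penalized log-loss lower bound, matrix form): Let T ≥ 2, let K be a T×T real symmetric positive semidefinite matrix, let a > 0, let κ² = max_i K_{ii}, and set B = √(6(1 + κ²/a)·log T). Let p : ℝ^T → ℝ be any nonnegative measurable function with ∫_{ℝ^T} p dy ≤ 1 (Lebesgue measure). Then there exists y ∈ ℝ^T with |y_i| ≤ B for all i such that p(y)·(1 − 1/T)·√(det(I + a⁻¹K)) ≤ exp(−m(y)), where m(y) := inf_{α ∈ ℝ^T} ( (1/2)‖y − Kα‖² + (T/2)·log(2π) + (a/2)·αᵀKα ). (Equivalently, whenever p(y) > 0, −log p(y) − m(y) ≥ (1/2)·log det(I + a⁻¹K) + log(1 − 1/T).) -/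

import Mathlib

open Matrix MeasureTheory

open ProbabilityTheory in
/-- A finite product of standard Gaussians has the product density. -/
lemma pi_gaussianReal_eq_withDensity (ι : Type*) [Fintype ι] :
    Measure.pi (fun _ : ι ↦ gaussianReal 0 1) =
      volume.withDensity (fun x : ι → ℝ ↦ ENNReal.ofReal (∏ i, gaussianPDFReal 0 1 (x i))) := by
  refine Measure.pi_eq fun s hs ↦ ?_
  rw [withDensity_apply _ (MeasurableSet.univ_pi hs), volume_pi, Measure.restrict_pi_pi,
    ← ofReal_integral_eq_lintegral_ofReal, integral_fintype_prod_eq_prod,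
    ENNReal.ofReal_prod_of_nonneg]
  · exact Finset.prod_congr rfl fun i _ ↦ (gaussianReal_apply_eq_integral 0 one_ne_zero _).symm
  · exact fun i _ ↦ integral_nonneg fun x ↦ gaussianPDFReal_nonneg 0 1 x
  · exact Integrable.fintype_prod fun i ↦ (integrable_gaussianPDFReal 0 1).restrict
  · exact ae_of_all _ fun x ↦ Finset.prod_nonneg fun i _ ↦ gaussianPDFReal_nonneg 0 1 _

open ProbabilityTheory in
/-- Two-sided sub-Gaussian tail bound for a centered real Gaussian. -/
lemma gaussianReal_abs_gt_le {v : NNReal} (hv : v ≠ 0) {B : ℝ} (hB : 0 ≤ B) :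
    (gaussianReal 0 v).real {x | B < |x|} ≤ 2 * Real.exp (-(B ^ 2 / (2 * v))) := by
  have hv' : (0 : ℝ) < v := by positivity
  have hval : Real.exp (-(B / v) * B) * Real.exp (0 * (B / v) + v * (B / v) ^ 2 / 2) =
      Real.exp (-(B ^ 2 / (2 * v))) := by
    rw [← Real.exp_add]; congr 1; field_simp; ring
  have h1 : (gaussianReal 0 v).real {x | B ≤ x} ≤ Real.exp (-(B ^ 2 / (2 * v))) := by
    have := measure_ge_le_exp_mul_mgf (X := id) (μ := gaussianReal 0 v) B (t := B / v)
      (by positivity) (integrable_exp_mul_gaussianReal _)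
    rwa [mgf_id_gaussianReal, hval] at this
  have h2 : (gaussianReal 0 v).real {x | x ≤ -B} ≤ Real.exp (-(B ^ 2 / (2 * v))) := by
    have := measure_le_le_exp_mul_mgf (X := id) (μ := gaussianReal 0 v) (-B) (t := -(B / v))
      (by simp; positivity) (integrable_exp_mul_gaussianReal _)
    rw [mgf_id_gaussianReal] at this
    calc _ ≤ _ := this
      _ = _ := by rw [← hval]; ring_nf
  calc (gaussianReal 0 v).real {x | B < |x|}
      ≤ (gaussianReal 0 v).real ({x | B ≤ x} ∪ {x | x ≤ -B}) := by
        refine measureReal_mono fun x hx ↦ ?_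
        rcases lt_abs.1 (show B < |x| from hx) with h | h
        · exact Or.inl h.le
        · exact Or.inr (show x ≤ -B by linarith)
    _ ≤ _ := (measureReal_union_le _ _).trans (by linarith)

/-- Upper bound on the penalized least-squares objective at the ridge solution. -/
lemma iInf_ridge_le {ι : Type*} [Fintype ι] [DecidableEq ι] {K : Matrix ι ι ℝ}
    (hK : K.PosSemidef) {a : ℝ} (ha : 0 < a) (c : ℝ) (y : ι → ℝ) :
    ⨅ α : ι → ℝ, ((1 / 2) * ((y - K *ᵥ α) ⬝ᵥ (y - K *ᵥ α)) + c + (a / 2) * (α ⬝ᵥ K *ᵥ α)) ≤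
      (1 / 2) * (y ⬝ᵥ (1 + a⁻¹ • K)⁻¹ *ᵥ y) + c := by
  have hS : (1 + a⁻¹ • K).PosDef := PosDef.one.add_posSemidef (hK.smul (inv_nonneg.2 ha.le))
  set z := (1 + a⁻¹ • K)⁻¹ *ᵥ y with hz
  have hy : z + a⁻¹ • K *ᵥ z = y := by
    have : (1 + a⁻¹ • K) *ᵥ z = y := by
      rw [hz, mulVec_mulVec, mul_nonsing_inv _ ((isUnit_iff_isUnit_det _).1 hS.isUnit), one_mulVec]
    rwa [add_mulVec, one_mulVec, smul_mulVec] at this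
  refine (ciInf_le ⟨c, ?_⟩ (a⁻¹ • z)).trans_eq ?_
  · rintro _ ⟨α, rfl⟩
    have h1 : 0 ≤ (y - K *ᵥ α) ⬝ᵥ (y - K *ᵥ α) := by
      simpa using dotProduct_star_self_nonneg (y - K *ᵥ α)
    have h2 : 0 ≤ α ⬝ᵥ K *ᵥ α := by simpa using hK.dotProduct_mulVec_nonneg α
    dsimp only
    nlinarith [mul_nonneg ha.le h2]
  · have : y - K *ᵥ (a⁻¹ • z) = z := by rw [mulVec_smul, sub_eq_iff_eq_add, hy]
    rw [this, mulVec_smul]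
    conv_rhs => rw [← hy]
    simp only [smul_dotProduct, dotProduct_smul, add_dotProduct, smul_eq_mul,
      dotProduct_comm (K *ᵥ z) z]
    field_simp
    ring

open ProbabilityTheory MatrixOrder in
/-- The nondegenerate centered multivariate Gaussian has the usual density. -/
lemma multivariateGaussian_apply_eq_lintegral {ι : Type*} [Fintype ι] [DecidableEq ι]
    {S : Matrix ι ι ℝ} (hS : S.PosDef) {s : Set (ι → ℝ)} (hs : MeasurableSet s) :
    multivariateGaussian 0 S (WithLp.ofLp ⁻¹' s) =
      ∫⁻ y in s, ENNReal.ofReal ((√(2 * Real.pi) ^ Fintype.card ι * √S.det)⁻¹ *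
        Real.exp (-((1 / 2) * (y ⬝ᵥ S⁻¹ *ᵥ y)))) := by
  set A := CFC.sqrt S with hA
  have hAA : A * A = S := CFC.sqrt_mul_sqrt_self S hS.posSemidef.nonneg
  have hAT : Aᵀ = A := by
    simpa using (nonneg_iff_posSemidef.1 (CFC.sqrt_nonneg S)).isHermitian.eq
  have hdet : A.det * A.det = S.det := by rw [← det_mul, hAA]
  have hA0 : A.det ≠ 0 := fun h ↦ hS.det_pos.ne' (by rw [← hdet, h, zero_mul])
  have habs : √S.det = |A.det| := by rw [← hdet, Real.sqrt_mul_self_eq_abs]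
  have hvol : (volume : Measure (ι → ℝ)) =
      ENNReal.ofReal |A.det| • Measure.map (toLin' A) volume := by
    rw [Real.map_matrix_volume_pi_eq_smul_volume_pi hA0, smul_smul,
      ← ENNReal.ofReal_mul (abs_nonneg _), abs_inv, mul_inv_cancel₀ (abs_ne_zero.2 hA0),
      ENNReal.ofReal_one, one_smul]
  have hmeas : Measurable (toLin' A) := (toLin' A).continuous_of_finiteDimensional.measurable
  have hquad (x : ι → ℝ) : (A *ᵥ x) ⬝ᵥ S⁻¹ *ᵥ (A *ᵥ x) = x ⬝ᵥ x := by
    have hinv : A * S⁻¹ * A = 1 := by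
      rw [← hAA, Matrix.mul_inv_rev, ← Matrix.mul_assoc, mul_nonsing_inv _ hA0.isUnit,
        Matrix.one_mul, nonsing_inv_mul _ hA0.isUnit]
    rw [dotProduct_comm, ← dotProduct_transpose_mulVec, hAT, mulVec_mulVec, mulVec_mulVec,
      hinv, one_mulVec]
  have hgauss : multivariateGaussian 0 S =
      (Measure.pi fun _ : ι ↦ gaussianReal 0 1).map (fun x ↦ WithLp.toLp 2 (toLin' A x)) := by
    rw [multivariateGaussian, ← map_pi_eq_stdGaussian, Measure.map_map (by fun_prop) (by fun_prop)]
    congr 1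
    ext x i
    simp [hA]
  rw [hgauss, Measure.map_apply (by fun_prop) (hs.preimage (by fun_prop)),
    pi_gaussianReal_eq_withDensity, ← Set.preimage_comp,
    show WithLp.ofLp ∘ (fun x ↦ WithLp.toLp 2 (toLin' A x)) = toLin' A from rfl,
    withDensity_apply _ (hs.preimage hmeas)]
  conv_rhs => rw [hvol]
  rw [Measure.restrict_smul, lintegral_smul_measure, setLIntegral_map hs (by fun_prop) hmeas,
    smul_eq_mul, ← lintegral_const_mul _ (by fun_prop)]
  refine lintegral_congr fun x ↦ ?_
  rw [← ENNReal.ofReal_mul (abs_nonneg _), toLin'_apply, hquad, habs]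
  congr 1
  simp only [gaussianPDFReal, Finset.prod_mul_distrib, ← Real.exp_sum, NNReal.coe_one, mul_one,
    sub_zero, Finset.prod_const, Finset.card_univ]
  have : |A.det| ≠ 0 := abs_ne_zero.2 hA0
  rw [mul_inv, inv_pow, dotProduct, Finset.mul_sum, ← Finset.sum_neg_distrib]
  field_simp

open ProbabilityTheory in
/-- Union bound for a centered multivariate Gaussian to lie in a cube. -/
lemma one_sub_le_multivariateGaussian_box {ι : Type*} [Fintype ι] [DecidableEq ι]
    {S : Matrix ι ι ℝ} (hS : S.PosDef) {B : ℝ} (hB : 0 ≤ B) :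
    1 - ∑ i, 2 * Real.exp (-(B ^ 2 / (2 * S i i))) ≤
      (multivariateGaussian 0 S).real (WithLp.ofLp ⁻¹' {y : ι → ℝ | ∀ i, |y i| ≤ B}) := by
  set μ := multivariateGaussian 0 S
  have hmeas : MeasurableSet (WithLp.ofLp ⁻¹' {y : ι → ℝ | ∀ i, |y i| ≤ B} :
      Set (EuclideanSpace ℝ ι)) := by
    simp only [Set.preimage_ofPred_eq]
    measurability
  have hcompl : (WithLp.ofLp ⁻¹' {y : ι → ℝ | ∀ i, |y i| ≤ B})ᶜ =
      ⋃ i, {x : EuclideanSpace ℝ ι | B < |x i|} := by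
    ext x; simp
  have htail (i : ι) : μ.real {x | B < |x i|} ≤ 2 * Real.exp (-(B ^ 2 / (2 * S i i))) := by
    have hii : 0 < S i i := hS.diag_pos
    have hmp := measurePreserving_eval_multivariateGaussian (μ := 0) hS.posSemidef (i := i)
    have := gaussianReal_abs_gt_le (v := (S i i).toNNReal) (by simpa using hii) hB
    rw [Real.coe_toNNReal _ hii.le] at this
    have hB' : MeasurableSet {x : ℝ | B < |x|} := measurableSet_lt (by fun_prop) (by fun_prop)
    exact (hmp.measureReal_preimage hB'.nullMeasurableSet).trans_le this
  have h1 := probReal_compl_eq_one_sub (μ := μ) hmeas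
  have h2 := measureReal_iUnion_fintype_le (μ := μ) (fun i ↦ {x : EuclideanSpace ℝ ι | B < |x i|})
  rw [hcompl] at h1
  linarith [Finset.sum_le_sum fun i (_ : i ∈ Finset.univ) ↦ htail i]

/-- Lemma 3 (penalized log-loss lower bound, matrix form): for any sub-probability
density `p` on `ℝ^T` there is a label sequence `y` in the box `[-B, B]^T` (with
`B = √(6 (1 + κ²/a) log T)`, `κ² = max_i K i i`) such that
`p y · (1 - 1/T) · √(det (I + a⁻¹ K)) ≤ exp (-m y)`, where
`m y = inf_α (½‖y - Kα‖² + (T/2) log (2π) + (a/2) αᵀKα)`. -/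
theorem penalized_log_loss_lower_bound (T : ℕ) (hT : 2 ≤ T)
    (K : Matrix (Fin T) (Fin T) ℝ) (hK : K.PosSemidef) (a : ℝ) (ha : 0 < a)
    (κ2 : ℝ) (hκ2 : κ2 = ⨆ i, K i i)
    (B : ℝ) (hB : B = Real.sqrt (6 * (1 + κ2 / a) * Real.log T))
    (p : (Fin T → ℝ) → ℝ) (hp : Measurable p) (hpnn : ∀ y, 0 ≤ p y)
    (hpint : ∫⁻ y, ENNReal.ofReal (p y) ≤ 1) :
    ∃ y : Fin T → ℝ, (∀ i, |y i| ≤ B) ∧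
      p y * ((1 - 1 / (T : ℝ)) *
          Real.sqrt ((1 + a⁻¹ • K : Matrix (Fin T) (Fin T) ℝ).det)) ≤
        Real.exp (-(⨅ α : Fin T → ℝ,
          ((1 / 2) * ((y - K.mulVec α) ⬝ᵥ (y - K.mulVec α)) +
            ((T : ℝ) / 2) * Real.log (2 * Real.pi) +
            (a / 2) * (α ⬝ᵥ K.mulVec α)))) := by
  have hT0 : (0 : ℝ) < T := by positivity
  have hT2 : (2 : ℝ) ≤ T := by exact_mod_cast hT
  have : Nonempty (Fin T) := ⟨⟨0, by omega⟩⟩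
  have hlog : 0 < Real.log T := Real.log_pos (by linarith)
  set S : Matrix (Fin T) (Fin T) ℝ := 1 + a⁻¹ • K with hSdef
  have hS : S.PosDef := PosDef.one.add_posSemidef (hK.smul (inv_nonneg.2 ha.le))
  have hSii (i : Fin T) : S i i ≤ 1 + κ2 / a := by
    have : K i i ≤ κ2 := hκ2 ▸ le_ciSup (Set.finite_range fun i ↦ K i i).bddAbove i
    simp only [hSdef, Matrix.add_apply, one_apply_eq, Matrix.smul_apply, smul_eq_mul,
      inv_mul_eq_div]
    gcongr
  have hκ : 0 < 1 + κ2 / a := (hS.diag_pos (i := Classical.arbitrary _)).trans_le (hSii _)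
  have hBpos : 0 < B := hB ▸ Real.sqrt_pos.2 (by positivity)
  have hBsq : B ^ 2 = 6 * (1 + κ2 / a) * Real.log T := by
    rw [hB, Real.sq_sqrt (by positivity)]
  set box : Set (Fin T → ℝ) := {y | ∀ i, |y i| ≤ B} with hbox
  have hboxIcc : box = Set.Icc (fun _ ↦ -B) (fun _ ↦ B) := by
    ext y; simp [hbox, abs_le, Pi.le_def, forall_and]
  have hboxm : MeasurableSet box := hboxIcc ▸ measurableSet_Icc
  have hboxpos : volume box ≠ 0 := by
    rw [hboxIcc, Real.volume_Icc_pi]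
    exact Finset.prod_ne_zero_iff.2 fun i _ ↦ by simp; linarith
  set q : (Fin T → ℝ) → ℝ := fun y ↦ (√(2 * Real.pi) ^ Fintype.card (Fin T) * √S.det)⁻¹ *
    Real.exp (-((1 / 2) * (y ⬝ᵥ S⁻¹ *ᵥ y))) with hq
  have hsqrt : 0 < √S.det := Real.sqrt_pos.2 hS.det_pos
  have hmass : ENNReal.ofReal (1 - 1 / (T : ℝ)) ≤ ∫⁻ y in box, ENNReal.ofReal (q y) := by
    rw [← multivariateGaussian_apply_eq_lintegral hS hboxm, ← ofReal_measureReal]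
    refine ENNReal.ofReal_le_ofReal (le_trans ?_ (one_sub_le_multivariateGaussian_box hS hBpos.le))
    have hterm (i : Fin T) : 2 * Real.exp (-(B ^ 2 / (2 * S i i))) ≤ 2 * ((T : ℝ) ^ 3)⁻¹ := by
      have hii : 0 < S i i := hS.diag_pos
      have : 3 * Real.log T ≤ B ^ 2 / (2 * S i i) := by
        rw [le_div_iff₀ (by positivity), hBsq]
        nlinarith [hSii i]
      rw [← Real.exp_log (pow_pos hT0 3), ← Real.exp_neg, Real.log_pow]
      gcongr
      simpa using this
    have hsum := Finset.sum_le_sum fun i (_ : i ∈ Finset.univ) ↦ hterm i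
    have : (T : ℝ) * (2 * ((T : ℝ) ^ 3)⁻¹) ≤ 1 / T := by
      rw [← sub_nonneg]
      have : 1 / (T : ℝ) - T * (2 * ((T : ℝ) ^ 3)⁻¹) = (T - 2) / T ^ 2 := by field_simp
      rw [this]
      exact div_nonneg (by linarith) (by positivity)
    simp only [Finset.sum_const, Finset.card_univ, Fintype.card_fin, nsmul_eq_mul] at hsum
    linarith
  have hm (y : Fin T → ℝ) : q y * √S.det ≤ Real.exp (-(⨅ α : Fin T → ℝ,
      ((1 / 2) * ((y - K.mulVec α) ⬝ᵥ (y - K.mulVec α)) +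
        ((T : ℝ) / 2) * Real.log (2 * Real.pi) + (a / 2) * (α ⬝ᵥ K.mulVec α)))) := by
    refine le_of_eq_of_le ?_
      (Real.exp_le_exp.2 (neg_le_neg (iInf_ridge_le hK ha ((T : ℝ) / 2 * Real.log (2 * Real.pi)) y)))
    have hpow : √(2 * Real.pi) ^ T = Real.exp ((T : ℝ) / 2 * Real.log (2 * Real.pi)) := by
      rw [← Real.exp_log (pow_pos (Real.sqrt_pos.2 Real.two_pi_pos) T), Real.log_pow,
        Real.log_sqrt Real.two_pi_pos.le]
      congr 1; ring
    rw [neg_add, Real.exp_add, Real.exp_neg ((T : ℝ) / 2 * _), ← hpow]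
    simp only [hq, Fintype.card_fin, ← hSdef]
    field_simp
  by_contra! hcon
  have hlt (y : Fin T → ℝ) (hy : y ∈ box) :
      ENNReal.ofReal (q y) < ENNReal.ofReal (1 - 1 / (T : ℝ)) * ENNReal.ofReal (p y) := by
    have hc : 0 ≤ 1 - 1 / (T : ℝ) := by
      rw [sub_nonneg, div_le_one hT0]; linarith
    have h := (hm y).trans_lt (hcon y hy)
    rw [← mul_assoc] at h
    have h' := lt_of_mul_lt_mul_right h hsqrt.le
    rw [← ENNReal.ofReal_mul hc, mul_comm (1 - 1 / (T : ℝ))]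
    exact (ENNReal.ofReal_lt_ofReal_iff_of_nonneg (by positivity)).2 h'
  have hup : ∫⁻ y in box, ENNReal.ofReal (1 - 1 / (T : ℝ)) * ENNReal.ofReal (p y) ≤
      ENNReal.ofReal (1 - 1 / (T : ℝ)) := by
    rw [lintegral_const_mul _ hp.ennreal_ofReal]
    exact mul_le_of_le_one_right' ((setLIntegral_le_lintegral _ _).trans hpint)
  have hfin : ∫⁻ y in box, ENNReal.ofReal (q y) ≠ ⊤ :=
    ((setLIntegral_mono (hp.ennreal_ofReal.const_mul _) fun y hy ↦ (hlt y hy).le).trans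
      hup).trans_lt ENNReal.ofReal_lt_top |>.ne
  exact ((hmass.trans_lt (setLIntegral_strict_mono hboxm hboxpos (hp.ennreal_ofReal.const_mul _)
    hfin (ae_of_all _ hlt))).trans_le hup).false
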